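/- Assume Hypothesis A and that φ is twice continuously differentiable. Let T > 0 and let γ : [0,T] × [0,1] → ℝ³ be continuously differentiable in (t,ξ) with γ(t,0) = γ(t,1) for all t, solving ∂_tγ(t,ξ) = u_t(γ(t,ξ)) with u_t(x) = ∫₀¹ ∇φ(x − γ(t,η)) ∧ ∂_ηγ(t,η) dη. Then for every t ∈ [0,T], ‖∂_ξγ(t,·)‖_{L²(0,1)} ≤ ‖∂_ξγ(0,·)‖_{L²(0,1)} · exp(C H(γ(0,·))^{1/2} t), where C = (1/(2π^{3/2})) (∫_{ℝ³} |k|⁴ φ̂(k) dk)^{1/2}. -/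

import Mathlib

noncomputable section
open MeasureTheory Real Set

/-- Three-dimensional Euclidean space. -/
abbrev E3 := EuclideanSpace ℝ (Fin 3)

/-- The Fourier transform `∫_{ℝ³} e^{i⟨k,x⟩} f(x) dx` of `f : ℝ³ → ℝ`, as a complex number. -/
def fourierInt (f : E3 → ℝ) (k : E3) : ℂ :=
  ∫ x : E3, Complex.exp (Complex.I * ((inner ℝ k x : ℝ) : ℂ)) * (f x : ℂ)

/-- Hypothesis A: `φ` is even, continuous, integrable, its Fourier transform is the real
nonnegative function `φhat`, and `φhat` satisfies the moment condition (A.4). -/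
structure HypA (φ : E3 → ℝ) (φhat : E3 → ℝ) : Prop where
  even : ∀ x, φ (-x) = φ x
  cont : Continuous φ
  integrable : Integrable φ
  fourier_eq : ∀ k, (φhat k : ℂ) = fourierInt φ k
  nonneg : ∀ k, 0 ≤ φhat k
  moment : Integrable (fun k : E3 => (1 + ‖k‖ ^ 2) ^ 2 * φhat k)

/-- `γ : [0,1] → ℝ³` is a closed curve, absolutely continuous with derivative `γd`
belonging to `L²((0,1); ℝ³)`. -/
structure IsH1Loop (γ γd : ℝ → E3) : Prop where
  closed : γ 0 = γ 1
  deriv_eq : ∀ ξ ∈ Icc (0:ℝ) 1, γ ξ = γ 0 + ∫ s in (0:ℝ)..ξ, γd s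
  memL2 : MemLp γd 2 (volume.restrict (Ioc (0:ℝ) 1))

/-- The kinetic energy `H(γ) = (1/2)∫₀¹∫₀¹ φ(γ(ξ)-γ(η)) ⟨γ'(ξ), γ'(η)⟩ dξ dη`. -/
def energy (φ : E3 → ℝ) (γ γd : ℝ → E3) : ℝ :=
  (1 / 2) * ∫ ξ in (0:ℝ)..1, ∫ η in (0:ℝ)..1, φ (γ ξ - γ η) * (inner ℝ (γd ξ) (γd η) : ℝ)

/-- The cross product on `ℝ³`. -/
def cross3 (a b : E3) : E3 := WithLp.toLp 2 (crossProduct (WithLp.ofLp a) (WithLp.ofLp b))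

/-- The induced velocity `u(x) = ∫₀¹ ∇φ(x - γ(ξ)) ∧ γ'(ξ) dξ`. -/
def velocity (φ : E3 → ℝ) (γ γd : ℝ → E3) (x : E3) : E3 :=
  ∫ ξ in (0:ℝ)..1, cross3 (gradient φ (x - γ ξ)) (γd ξ)

theorem hasDerivAt_intervalIntegral_of_continuous {E : Type*} [NormedAddCommGroup E]
    [NormedSpace ℝ E] {f f' : ℝ → ℝ → E} (hf : Continuous fun p : ℝ × ℝ => f p.1 p.2)
    (hf' : Continuous fun p : ℝ × ℝ => f' p.1 p.2) {a b x₀ : ℝ} (hab : a ≤ b) {s : Set ℝ}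
    (hs : s ∈ nhds x₀)
    (h : ∀ x ∈ s, ∀ y ∈ Ioo a b, HasDerivAt (fun x => f x y) (f' x y) x) :
    HasDerivAt (fun x => ∫ y in a..b, f x y) (∫ y in a..b, f' x₀ y) x₀ := by
  obtain ⟨M, hM⟩ := ((isCompact_Icc (a := x₀ - 1) (b := x₀ + 1)).prod
    (isCompact_Icc (a := a) (b := b))).exists_bound_of_continuousOn hf'.continuousOn
  have hmem : s ∩ Icc (x₀ - 1) (x₀ + 1) ∈ nhds x₀ :=
    Filter.inter_mem hs (Icc_mem_nhds (by linarith) (by linarith))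
  have hc : ∀ x, Continuous (f x) := fun x => hf.comp (by fun_prop : Continuous fun y => (x, y))
  have hc' : ∀ x, Continuous (f' x) := fun x => hf'.comp (by fun_prop : Continuous fun y => (x, y))
  refine (intervalIntegral.hasDerivAt_integral_of_dominated_loc_of_deriv_le (bound := fun _ => M)
    (μ := volume) hmem (.of_forall fun x => (hc x).aestronglyMeasurable)
    ((hc x₀).intervalIntegrable a b) (hc' x₀).aestronglyMeasurable ?_
    intervalIntegrable_const ?_).2
  · refine .of_forall fun y hy x hx => hM (x, y) ⟨hx.2, ?_⟩
    rw [uIoc_of_le hab] at hy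
    exact ⟨hy.1.le, hy.2⟩
  · have hb : ∀ᵐ y : ℝ, y ≠ b := by simp [ae_iff, measure_singleton]
    filter_upwards [hb] with y hyb hy x hx
    rw [uIoc_of_le hab] at hy
    exact h x hx.1 y ⟨hy.1, lt_of_le_of_ne hy.2 hyb⟩

theorem integrable_prod_Ioc_of_continuous {E : Type*} [NormedAddCommGroup E]
    {f : ℝ × ℝ → E} (hf : Continuous f) (a b c d : ℝ) :
    Integrable f ((volume.restrict (Ioc a b)).prod (volume.restrict (Ioc c d))) := by
  rw [Measure.prod_restrict]
  exact (hf.continuousOn.integrableOn_compact (isCompact_Icc.prod isCompact_Icc)).mono_set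
    (prod_mono Ioc_subset_Icc_self Ioc_subset_Icc_self)

theorem intervalIntegral_swap_of_continuous {E : Type*} [NormedAddCommGroup E]
    [NormedSpace ℝ E] {f : ℝ → ℝ → E} (hf : Continuous fun p : ℝ × ℝ => f p.1 p.2) {a b c d : ℝ}
    (hab : a ≤ b) (hcd : c ≤ d) :
    ∫ x in a..b, ∫ y in c..d, f x y = ∫ y in c..d, ∫ x in a..b, f x y := by
  simp_rw [intervalIntegral.integral_of_le hcd, intervalIntegral.integral_of_le hab]
  exact integral_integral_swap (integrable_prod_Ioc_of_continuous hf a b c d)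

theorem inner_cross3_cross3 (a b c d : E3) :
    inner ℝ (cross3 a b) (cross3 c d) = inner ℝ a c * inner ℝ b d - inner ℝ a d * inner ℝ b c := by
  simp [cross3, PiLp.inner_apply, Fin.sum_univ_three, crossProduct]
  ring

theorem inner_cross3_self (a b : E3) : inner ℝ a (cross3 a b) = 0 := by
  simp [cross3, PiLp.inner_apply, Fin.sum_univ_three, crossProduct]
  ring

theorem norm_cross3_le (a b : E3) : ‖cross3 a b‖ ≤ ‖a‖ * ‖b‖ := by
  refine le_of_sq_le_sq ?_ (by positivity)
  rw [← real_inner_self_eq_norm_sq, inner_cross3_cross3, real_inner_self_eq_norm_sq,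
    real_inner_self_eq_norm_sq, real_inner_comm a b]
  nlinarith [mul_self_nonneg (inner ℝ a b : ℝ)]

/-- The cross product as a continuous bilinear map. -/
def crossCLM : E3 →L[ℝ] E3 →L[ℝ] E3 :=
  LinearMap.mkContinuous₂ (LinearMap.mk₂ ℝ cross3
    (fun a b c => by simp [cross3]) (fun r a b => by simp [cross3])
    (fun a b c => by simp [cross3]) (fun r a b => by simp [cross3])) 1
    fun a b => by rw [one_mul]; exact norm_cross3_le a b

@[simp] theorem crossCLM_apply (a b : E3) : crossCLM a b = cross3 a b := rfl

theorem HypA.integrable_pow_mul {φ φhat : E3 → ℝ} (hA : HypA φ φhat) {n : ℕ} (hn : n ≤ 4) :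
    Integrable fun k : E3 => ‖k‖ ^ n * φhat k := by
  have h : (fun k : E3 => ‖k‖ ^ n * φhat k) =
      fun k => (‖k‖ ^ n / (1 + ‖k‖ ^ 2) ^ 2) * ((1 + ‖k‖ ^ 2) ^ 2 * φhat k) := by
    ext k
    have : (1 + ‖k‖ ^ 2) ^ 2 ≠ 0 := by positivity
    field_simp
  rw [h]
  refine hA.moment.bdd_mul (c := 1) ?_ (.of_forall fun k => ?_)
  · refine Continuous.aestronglyMeasurable ?_
    refine Continuous.div (by fun_prop) (by fun_prop) fun k => by positivity
  · rw [norm_of_nonneg (by positivity), div_le_one (by positivity)]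
    have := norm_nonneg k
    rcases le_total ‖k‖ 1 with h1 | h1
    · calc ‖k‖ ^ n ≤ 1 := pow_le_one₀ this h1
        _ ≤ _ := one_le_pow₀ (by nlinarith)
    · calc ‖k‖ ^ n ≤ ‖k‖ ^ 4 := pow_le_pow_right₀ h1 hn
        _ ≤ _ := by nlinarith [sq_nonneg ‖k‖]

theorem HypA.integrable_hat {φ φhat : E3 → ℝ} (hA : HypA φ φhat) : Integrable φhat := by
  simpa using hA.integrable_pow_mul (n := 0) (by norm_num)

theorem HypA.fourier_eq_hat {φ φhat : E3 → ℝ} (hA : HypA φ φhat) (w : E3) :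
    FourierTransform.fourier (fun x => (φ x : ℂ)) w = (φhat ((-(2 * π)) • w) : ℂ) := by
  rw [hA.fourier_eq, Real.fourier_eq', fourierInt]
  congr 1
  ext x
  rw [smul_eq_mul, inner_smul_left, real_inner_comm]
  congr 2
  simp
  ring

theorem HypA.eq_integral_cos {φ φhat : E3 → ℝ} (hA : HypA φ φhat) (x : E3) :
    φ x = ((2 * π) ^ 3)⁻¹ * ∫ k : E3, φhat k * Real.cos (inner ℝ k x) := by
  have h2 : (-(2 * π)) ≠ 0 := by simp [pi_ne_zero]
  have hcont : Continuous fun x => (φ x : ℂ) := Complex.continuous_ofReal.comp hA.cont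
  have hint : Integrable fun x => (φ x : ℂ) := hA.integrable.ofReal
  have hF : FourierTransform.fourier (fun x => (φ x : ℂ)) =
      fun w => (φhat ((-(2 * π)) • w) : ℂ) := funext hA.fourier_eq_hat
  have hFint : Integrable (FourierTransform.fourier fun x => (φ x : ℂ)) := by
    rw [hF]
    exact (hA.integrable_hat.comp_smul h2).ofReal
  have h := congrFun (hcont.fourierInv_fourier_eq hint hFint) x
  rw [hF, Real.fourierInv_eq'] at h
  have key := Measure.integral_comp_smul (volume : Measure E3)
    (fun k => Complex.exp (↑(-(inner ℝ k x : ℝ)) * Complex.I) * (φhat k : ℂ)) (-(2 * π))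
  have hcong : ∀ w : E3, Complex.exp (↑(2 * π * (inner ℝ w x : ℝ)) * Complex.I) •
      (φhat ((-(2 * π)) • w) : ℂ) = Complex.exp (↑(-(inner ℝ ((-(2 * π)) • w) x : ℝ)) * Complex.I) *
        (φhat ((-(2 * π)) • w) : ℂ) := fun w => by
    rw [smul_eq_mul, inner_smul_left]
    simp
  rw [integral_congr_ae (.of_forall hcong), key] at h
  have h3 := congrArg Complex.re h
  rw [Complex.ofReal_re, Complex.real_smul, Complex.re_ofReal_mul] at h3
  rw [← h3]
  have hfr : Module.finrank ℝ E3 = 3 := by simp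
  have hint2 : Integrable fun k : E3 =>
      Complex.exp (↑(-(inner ℝ k x : ℝ)) * Complex.I) * (φhat k : ℂ) := by
    refine hA.integrable_hat.ofReal.bdd_mul (c := 1) ?_ (.of_forall fun k => ?_)
    · exact Continuous.aestronglyMeasurable (by fun_prop)
    · rw [Complex.norm_exp_ofReal_mul_I]
  congr 1
  · rw [hfr, abs_inv, abs_pow, abs_neg, abs_of_pos (by positivity)]
  · rw [← RCLike.re_eq_complex_re, ← integral_re hint2]
    congr 1
    ext k
    rw [RCLike.re_eq_complex_re, mul_comm, Complex.re_ofReal_mul, Complex.exp_ofReal_mul_I_re,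
      Real.cos_neg]

theorem HypA.gradient_eq {φ φhat : E3 → ℝ} (hA : HypA φ φhat) (x : E3) :
    gradient φ x = -((2 * π) ^ 3)⁻¹ • ∫ k : E3, (φhat k * Real.sin (inner ℝ k x)) • k := by
  have hk : Integrable fun k : E3 => ‖k‖ * φhat k := by
    simpa using hA.integrable_pow_mul (n := 1) (by norm_num)
  have hm : AEStronglyMeasurable φhat volume := hA.integrable_hat.1
  have hsm : ∀ y, AEStronglyMeasurable
      (fun k : E3 => (-(φhat k * Real.sin (inner ℝ k y))) • k) volume := fun y =>
    ((hm.mul (Continuous.aestronglyMeasurable (by fun_prop))).neg).smul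
      (Continuous.aestronglyMeasurable (by fun_prop))
  have hd : HasFDerivAt (fun x => ∫ k : E3, φhat k * Real.cos (inner ℝ k x))
      (∫ k : E3, InnerProductSpace.toDual ℝ E3 ((-(φhat k * Real.sin (inner ℝ k x))) • k)) x := by
    refine hasFDerivAt_integral_of_dominated_of_fderiv_le
      (F' := fun x k => InnerProductSpace.toDual ℝ E3 ((-(φhat k * Real.sin (inner ℝ k x))) • k))
      (bound := fun k => ‖k‖ * φhat k) Filter.univ_mem (.of_forall fun y => ?_) ?_ ?_ ?_ hk ?_
    · exact hm.mul (Continuous.aestronglyMeasurable (by fun_prop))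
    · refine hA.integrable_hat.mul_bdd (c := 1) (Continuous.aestronglyMeasurable (by fun_prop))
        (.of_forall fun k => ?_)
      exact Real.abs_cos_le_one _
    · exact (InnerProductSpace.toDual ℝ E3).continuous.comp_aestronglyMeasurable (hsm x)
    · refine .of_forall fun k y _ => ?_
      rw [LinearIsometryEquiv.norm_map, norm_smul, norm_neg, norm_mul,
        norm_of_nonneg (hA.nonneg k), mul_comm]
      refine mul_le_mul_of_nonneg_left ?_ (norm_nonneg k)
      exact mul_le_of_le_one_right (hA.nonneg k) (Real.abs_sin_le_one _)
    · refine .of_forall fun k y _ => ?_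
      have h1 : HasFDerivAt (fun y : E3 => (inner ℝ k y : ℝ)) (InnerProductSpace.toDual ℝ E3 k) y :=
        (InnerProductSpace.toDual ℝ E3 k).hasFDerivAt
      refine (h1.cos.const_mul (φhat k)).congr_fderiv ?_
      rw [map_smul, smul_smul, mul_neg]
  have hφ : φ = fun x => ((2 * π) ^ 3)⁻¹ * ∫ k : E3, φhat k * Real.cos (inner ℝ k x) :=
    funext hA.eq_integral_cos
  have hg : HasGradientAt φ
      (-((2 * π) ^ 3)⁻¹ • ∫ k : E3, (φhat k * Real.sin (inner ℝ k x)) • k) x := by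
    rw [hasGradientAt_iff_hasFDerivAt, hφ]
    refine (hd.const_mul (((2 * π) ^ 3)⁻¹)).congr_fderiv ?_
    have : ∫ k : E3, InnerProductSpace.toDual ℝ E3 ((-(φhat k * Real.sin (inner ℝ k x))) • k) =
      InnerProductSpace.toDual ℝ E3 (∫ k : E3, (-(φhat k * Real.sin (inner ℝ k x))) • k) := 
      ((InnerProductSpace.toDual ℝ E3).toContinuousLinearEquiv.integral_comp_comm _)
    rw [this]
    simp [neg_smul, integral_neg]
  exact hg.gradient

theorem integral_mul_mul_le_sqrt_mul_sqrt {α : Type*} [MeasurableSpace α] {μ : Measure α}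
    {w a b : α → ℝ} (hw : 0 ≤ w) (ha : 0 ≤ a) (hb : 0 ≤ b) (hwm : AEStronglyMeasurable w μ)
    (ham : AEStronglyMeasurable a μ) (hbm : AEStronglyMeasurable b μ)
    (hwa : Integrable (fun x => a x ^ 2 * w x) μ) (hwb : Integrable (fun x => b x ^ 2 * w x) μ) :
    ∫ x, a x * b x * w x ∂μ ≤
      Real.sqrt (∫ x, a x ^ 2 * w x ∂μ) * Real.sqrt (∫ x, b x ^ 2 * w x ∂μ) := by
  have hs : AEStronglyMeasurable (fun x => Real.sqrt (w x)) μ :=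
    Real.continuous_sqrt.comp_aestronglyMeasurable hwm
  have hsq : ∀ (c : α → ℝ) x, (c x * Real.sqrt (w x)) ^ 2 = c x ^ 2 * w x := fun c x => by
    rw [mul_pow, Real.sq_sqrt (hw x)]
  have hmem : ∀ c : α → ℝ, AEStronglyMeasurable c μ → Integrable (fun x => c x ^ 2 * w x) μ →
      MemLp (fun x => c x * Real.sqrt (w x)) (ENNReal.ofReal 2) μ := fun c hc hi => by
    rw [ENNReal.ofReal_ofNat, memLp_two_iff_integrable_sq (hc.fun_mul hs)]
    simpa only [hsq] using hi
  have h := integral_mul_le_Lp_mul_Lq_of_nonneg (μ := μ) Real.HolderConjugate.two_two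
    (f := fun x => a x * Real.sqrt (w x)) (g := fun x => b x * Real.sqrt (w x))
    (.of_forall fun x => mul_nonneg (ha x) (Real.sqrt_nonneg _))
    (.of_forall fun x => mul_nonneg (hb x) (Real.sqrt_nonneg _)) (hmem a ham hwa) (hmem b hbm hwb)
  simp only [Real.rpow_two, hsq, ← Real.sqrt_eq_rpow] at h
  refine le_of_eq_of_le (integral_congr_ae (.of_forall fun x => ?_)) h
  have := Real.mul_self_sqrt (hw x)
  change a x * b x * w x = a x * Real.sqrt (w x) * (b x * Real.sqrt (w x))
  linear_combination (-(a x * b x)) * this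

theorem HypA.intervalIntegral_swap {F : Type*} [NormedAddCommGroup F] [NormedSpace ℝ F]
    {φ φhat : E3 → ℝ} (hA : HypA φ φhat) {n : ℕ} (hn : n ≤ 4) {g : ℝ → E3 → F}
    (hg : Continuous fun p : ℝ × E3 => g p.1 p.2) {b : ℝ → ℝ} (hb : Continuous b)
    (h : ∀ ξ k, ‖g ξ k‖ ≤ b ξ * ‖k‖ ^ n) :
    ∫ ξ in (0:ℝ)..1, ∫ k, φhat k • g ξ k = ∫ k, φhat k • ∫ ξ in (0:ℝ)..1, g ξ k := by
  simp_rw [← intervalIntegral.integral_smul]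
  refine intervalIntegral_integral_swap ?_
  rw [uIoc_of_le zero_le_one]
  have hb1 : Integrable b (volume.restrict (Ioc (0:ℝ) 1)) :=
    (hb.integrableOn_Icc).mono_set Ioc_subset_Icc_self
  refine (hb1.mul_prod (hA.integrable_pow_mul hn)).mono' ?_ (.of_forall fun p => ?_)
  · exact (hA.integrable_hat.1.comp_snd).smul hg.aestronglyMeasurable
  · simp only [Function.uncurry]
    rw [norm_smul, norm_of_nonneg (hA.nonneg _)]
    have := mul_le_mul_of_nonneg_left (h p.1 p.2) (hA.nonneg p.2)
    linarith

/-- The cosine transform of the vector measure carried by the curve. -/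
def cosTransform (γ γd : ℝ → E3) (k : E3) : E3 :=
  ∫ ξ in (0:ℝ)..1, Real.cos (inner ℝ k (γ ξ)) • γd ξ

/-- The sine transform of the vector measure carried by the curve. -/
def sinTransform (γ γd : ℝ → E3) (k : E3) : E3 :=
  ∫ ξ in (0:ℝ)..1, Real.sin (inner ℝ k (γ ξ)) • γd ξ

theorem continuous_cosTransform {γ γd : ℝ → E3} (hγ : Continuous γ) (hγd : Continuous γd) :
    Continuous (cosTransform γ γd) :=
  intervalIntegral.continuous_parametric_intervalIntegral_of_continuous' (by fun_prop) 0 1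

theorem continuous_sinTransform {γ γd : ℝ → E3} (hγ : Continuous γ) (hγd : Continuous γd) :
    Continuous (sinTransform γ γd) :=
  intervalIntegral.continuous_parametric_intervalIntegral_of_continuous' (by fun_prop) 0 1

theorem norm_smul_le_of_abs_le_one {E : Type*} [NormedAddCommGroup E] [NormedSpace ℝ E] {r : ℝ}
    (hr : |r| ≤ 1) (v : E) : ‖r • v‖ ≤ ‖v‖ := by
  rw [norm_smul]
  exact mul_le_of_le_one_left (norm_nonneg v) hr

theorem norm_cosTransform_le {γ γd : ℝ → E3} (hγd : Continuous γd) (k : E3) :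
    ‖cosTransform γ γd k‖ ≤ ∫ ξ in (0:ℝ)..1, ‖γd ξ‖ :=
  intervalIntegral.norm_integral_le_of_norm_le zero_le_one
    (.of_forall fun _ _ => norm_smul_le_of_abs_le_one (Real.abs_cos_le_one _) _)
    (hγd.norm.intervalIntegrable 0 1)

theorem norm_sinTransform_le {γ γd : ℝ → E3} (hγd : Continuous γd) (k : E3) :
    ‖sinTransform γ γd k‖ ≤ ∫ ξ in (0:ℝ)..1, ‖γd ξ‖ :=
  intervalIntegral.norm_integral_le_of_norm_le zero_le_one
    (.of_forall fun _ _ => norm_smul_le_of_abs_le_one (Real.abs_sin_le_one _) _)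
    (hγd.norm.intervalIntegrable 0 1)

theorem HypA.integrable_transforms {φ φhat : E3 → ℝ} (hA : HypA φ φhat) {γ γd : ℝ → E3}
    (hγ : Continuous γ) (hγd : Continuous γd) :
    Integrable fun k => φhat k * (‖cosTransform γ γd k‖ ^ 2 + ‖sinTransform γ γd k‖ ^ 2) := by
  have hC := continuous_cosTransform hγ hγd
  have hS := continuous_sinTransform hγ hγd
  refine hA.integrable_hat.mul_bdd
    (c := (∫ ξ in (0:ℝ)..1, ‖γd ξ‖) ^ 2 + (∫ ξ in (0:ℝ)..1, ‖γd ξ‖) ^ 2)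
    (Continuous.aestronglyMeasurable (by fun_prop)) (.of_forall fun k => ?_)
  rw [norm_of_nonneg (by positivity)]
  gcongr
  · exact norm_cosTransform_le hγd k
  · exact norm_sinTransform_le hγd k

theorem HypA.energy_eq {φ φhat : E3 → ℝ} (hA : HypA φ φhat) {γ γd : ℝ → E3}
    (hγ : Continuous γ) (hγd : Continuous γd) :
    energy φ γ γd = (1 / 2) * (((2 * π) ^ 3)⁻¹ *
      ∫ k, φhat k * (‖cosTransform γ γd k‖ ^ 2 + ‖sinTransform γ γd k‖ ^ 2)) := by
  have hC := continuous_cosTransform hγ hγd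
  have hS := continuous_sinTransform hγ hγd
  have hexp : ∀ ξ η, φ (γ ξ - γ η) * (inner ℝ (γd ξ) (γd η) : ℝ) =
      ((2 * π) ^ 3)⁻¹ * ∫ k, φhat k • (Real.cos (inner ℝ k (γ ξ - γ η)) *
        inner ℝ (γd ξ) (γd η)) := fun ξ η => by
    rw [hA.eq_integral_cos, mul_assoc, ← integral_mul_const]
    simp only [smul_eq_mul, mul_assoc]
  have hinner : ∀ ξ, ∫ η in (0:ℝ)..1, φ (γ ξ - γ η) * (inner ℝ (γd ξ) (γd η) : ℝ) =
      ((2 * π) ^ 3)⁻¹ * ∫ k, φhat k • (inner ℝ (γd ξ)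
        (Real.cos (inner ℝ k (γ ξ)) • cosTransform γ γd k +
          Real.sin (inner ℝ k (γ ξ)) • sinTransform γ γd k)) := fun ξ => by
    simp_rw [hexp, intervalIntegral.integral_const_mul]
    rw [hA.intervalIntegral_swap (n := 0) (b := fun η => ‖γd ξ‖ * ‖γd η‖) (by norm_num)
      (by fun_prop) (by fun_prop)]
    · congr 2
      ext k
      congr 1
      rw [cosTransform, sinTransform, ← intervalIntegral.integral_smul,
        ← intervalIntegral.integral_smul, ← intervalIntegral.integral_add
          (Continuous.intervalIntegrable (by fun_prop) 0 1)
          (Continuous.intervalIntegrable (by fun_prop) 0 1)]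
      refine Eq.trans ?_ ((innerSL ℝ (γd ξ)).intervalIntegral_comp_comm
        (Continuous.intervalIntegrable (by fun_prop) 0 1))
      congr 1
      ext η
      simp only [innerSL_apply_apply, inner_add_right, inner_smul_right, inner_sub_right,
        Real.cos_sub]
      ring
    · intro η k
      rw [pow_zero, mul_one, norm_mul]
      exact (mul_le_of_le_one_left (norm_nonneg _) (Real.abs_cos_le_one _)).trans
        (norm_inner_le_norm _ _)
  rw [energy]
  simp_rw [hinner, intervalIntegral.integral_const_mul]
  rw [hA.intervalIntegral_swap (n := 0)
    (b := fun ξ => ‖γd ξ‖ * ((∫ ξ in (0:ℝ)..1, ‖γd ξ‖) + ∫ ξ in (0:ℝ)..1, ‖γd ξ‖)) (by norm_num)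
    (by fun_prop) (by fun_prop)]
  · congr 3
    ext k
    rw [smul_eq_mul]
    congr 1
    have h1 : IntervalIntegrable (fun η => Real.cos (inner ℝ k (γ η)) • γd η) volume 0 1 :=
      Continuous.intervalIntegrable (by fun_prop) 0 1
    have h2 : IntervalIntegrable (fun η => Real.sin (inner ℝ k (γ η)) • γd η) volume 0 1 :=
      Continuous.intervalIntegrable (by fun_prop) 0 1
    have e1 := (innerSL ℝ (cosTransform γ γd k)).intervalIntegral_comp_comm h1
    have e2 := (innerSL ℝ (sinTransform γ γd k)).intervalIntegral_comp_comm h2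
    rw [← real_inner_self_eq_norm_sq, ← real_inner_self_eq_norm_sq]
    refine Eq.trans ?_ (congrArg₂ (· + ·) e1 e2)
    rw [← intervalIntegral.integral_add
      (Continuous.intervalIntegrable (by fun_prop) 0 1)
      (Continuous.intervalIntegrable (by fun_prop) 0 1)]
    congr 1
    ext ξ
    simp only [innerSL_apply_apply, inner_add_right, inner_smul_right, real_inner_comm (γd ξ)]
  · intro ξ k
    rw [pow_zero, mul_one]
    refine (norm_inner_le_norm _ _).trans (mul_le_mul_of_nonneg_left ?_ (norm_nonneg _))
    refine (norm_add_le _ _).trans (add_le_add ?_ ?_)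
    · exact (norm_smul_le_of_abs_le_one (Real.abs_cos_le_one _) _).trans
        (norm_cosTransform_le hγd k)
    · exact (norm_smul_le_of_abs_le_one (Real.abs_sin_le_one _) _).trans
        (norm_sinTransform_le hγd k)

theorem continuous_cross3 {X : Type*} [TopologicalSpace X] {f g : X → E3} (hf : Continuous f)
    (hg : Continuous g) : Continuous fun x => cross3 (f x) (g x) :=
  (crossCLM.continuous.comp hf).clm_apply hg

theorem HypA.integrable_smul {F : Type*} [NormedAddCommGroup F] [NormedSpace ℝ F]
    {φ φhat : E3 → ℝ} (hA : HypA φ φhat) {n : ℕ} (hn : n ≤ 4) {g : E3 → F}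
    (hg : Continuous g) {b : ℝ} (h : ∀ k, ‖g k‖ ≤ b * ‖k‖ ^ n) :
    Integrable fun k => φhat k • g k := by
  refine ((hA.integrable_pow_mul hn).const_mul b).mono'
    (hA.integrable_hat.1.smul hg.aestronglyMeasurable) (.of_forall fun k => ?_)
  rw [norm_smul, norm_of_nonneg (hA.nonneg _)]
  have := mul_le_mul_of_nonneg_left (h k) (hA.nonneg k)
  linarith

theorem HypA.velocity_eq {φ φhat : E3 → ℝ} (hA : HypA φ φhat) {γ γd : ℝ → E3}
    (hγ : Continuous γ) (hγd : Continuous γd) (x : E3) :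
    velocity φ γ γd x = -((2 * π) ^ 3)⁻¹ • ∫ k, φhat k • cross3 k
      (Real.sin (inner ℝ k x) • cosTransform γ γd k -
        Real.cos (inner ℝ k x) • sinTransform γ γd k) := by
  have hexp : ∀ ξ, cross3 (gradient φ (x - γ ξ)) (γd ξ) = -((2 * π) ^ 3)⁻¹ •
      ∫ k, φhat k • cross3 k (Real.sin (inner ℝ k (x - γ ξ)) • γd ξ) := fun ξ => by
    have hi : Integrable fun k => (φhat k * Real.sin (inner ℝ k (x - γ ξ))) • k := by
      simp_rw [mul_smul]
      refine hA.integrable_smul (n := 1) (b := 1) (by norm_num) (by fun_prop) fun k => ?_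
      simpa using norm_smul_le_of_abs_le_one (Real.abs_sin_le_one _) k
    have h := (crossCLM.flip (γd ξ)).integral_comp_comm hi
    rw [hA.gradient_eq, ← crossCLM_apply, ← ContinuousLinearMap.flip_apply, map_smul, ← h]
    congr 2
    ext1 k
    rw [map_smul, mul_smul, ContinuousLinearMap.flip_apply, ← crossCLM_apply, map_smul]
  rw [velocity]
  simp_rw [hexp, intervalIntegral.integral_smul]
  rw [hA.intervalIntegral_swap (n := 1) (b := fun ξ => ‖γd ξ‖) (by norm_num)
      (continuous_cross3 (by fun_prop) (by fun_prop)) (by fun_prop)]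
  · congr 2
    ext1 k
    congr 1
    rw [cosTransform, sinTransform, ← intervalIntegral.integral_smul,
      ← intervalIntegral.integral_smul, ← intervalIntegral.integral_sub
        (Continuous.intervalIntegrable (by fun_prop) 0 1)
        (Continuous.intervalIntegrable (by fun_prop) 0 1)]
    refine Eq.trans ?_ ((crossCLM k).intervalIntegral_comp_comm
      (Continuous.intervalIntegrable (by fun_prop) 0 1))
    congr 1
    ext1 ξ
    rw [crossCLM_apply, inner_sub_right, Real.sin_sub, sub_smul, mul_smul, mul_smul]
  · intro ξ k
    refine (norm_cross3_le _ _).trans ?_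
    rw [pow_one, mul_comm]
    exact mul_le_mul_of_nonneg_right
      (norm_smul_le_of_abs_le_one (Real.abs_sin_le_one _) _) (norm_nonneg _)

theorem norm_smul_sub_smul_le {E : Type*} [NormedAddCommGroup E] [NormedSpace ℝ E] (a b : ℝ)
    (u v : E) :
    ‖a • u - b • v‖ ≤ Real.sqrt (a ^ 2 + b ^ 2) * Real.sqrt (‖u‖ ^ 2 + ‖v‖ ^ 2) := by
  rw [← Real.sqrt_mul (by positivity)]
  refine Real.le_sqrt_of_sq_le ?_
  have h : ‖a • u - b • v‖ ≤ |a| * ‖u‖ + |b| * ‖v‖ := by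
    simpa [norm_smul] using norm_sub_le (a • u) (b • v)
  calc ‖a • u - b • v‖ ^ 2 ≤ (|a| * ‖u‖ + |b| * ‖v‖) ^ 2 := by gcongr
    _ ≤ (|a| ^ 2 + |b| ^ 2) * (‖u‖ ^ 2 + ‖v‖ ^ 2) := by
      nlinarith [sq_nonneg (|a| * ‖v‖ - |b| * ‖u‖)]
    _ = _ := by rw [sq_abs, sq_abs]

theorem sqrt_sin_sub_sq_add_cos_sub_sq_le (a b : ℝ) :
    Real.sqrt ((Real.sin a - Real.sin b) ^ 2 + (Real.cos a - Real.cos b) ^ 2) ≤ |a - b| := by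
  refine Real.sqrt_le_iff.mpr ⟨abs_nonneg _, ?_⟩
  rw [sq_abs]
  have h := Real.one_sub_sq_div_two_le_cos (x := a - b)
  rw [Real.cos_sub] at h
  nlinarith [Real.sin_sq_add_cos_sq a, Real.sin_sq_add_cos_sq b]

theorem HypA.norm_velocity_sub_le {φ φhat : E3 → ℝ} (hA : HypA φ φhat) {γ γd : ℝ → E3}
    (hγ : Continuous γ) (hγd : Continuous γd) (x y : E3) :
    ‖velocity φ γ γd x - velocity φ γ γd y‖ ≤ (1 / (2 * π ^ ((3:ℝ) / 2))) *
      Real.sqrt (∫ k : E3, ‖k‖ ^ 4 * φhat k) * Real.sqrt (energy φ γ γd) * ‖x - y‖ := by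
  have hC := continuous_cosTransform hγ hγd
  have hS := continuous_sinTransform hγ hγd
  set C := cosTransform γ γd with hCdef
  set S := sinTransform γ γd with hSdef
  set N : E3 → ℝ := fun k => Real.sqrt (‖C k‖ ^ 2 + ‖S k‖ ^ 2) with hN
  have hN0 : 0 ≤ N := fun k => Real.sqrt_nonneg _
  have hNsq : ∀ k, N k ^ 2 = ‖C k‖ ^ 2 + ‖S k‖ ^ 2 := fun k => Real.sq_sqrt (by positivity)
  have hNc : Continuous N := by fun_prop
  have hNint : Integrable fun k => N k ^ 2 * φhat k := by
    simp_rw [hNsq, mul_comm _ (φhat _)]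
    exact hA.integrable_transforms hγ hγd
  have hkint : Integrable fun k : E3 => (‖k‖ ^ 2) ^ 2 * φhat k := by
    simpa only [← pow_mul] using hA.integrable_pow_mul (n := 4) le_rfl
  have hint : ∀ z : E3, Integrable fun k => φhat k • cross3 k
      (Real.sin (inner ℝ k z) • C k - Real.cos (inner ℝ k z) • S k) := fun z => by
    refine hA.integrable_smul (n := 1)
      (b := (∫ ξ in (0:ℝ)..1, ‖γd ξ‖) + ∫ ξ in (0:ℝ)..1, ‖γd ξ‖) (by norm_num)
      (continuous_cross3 (by fun_prop) (by fun_prop)) fun k => ?_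
    refine (norm_cross3_le _ _).trans ?_
    rw [pow_one, mul_comm]
    refine mul_le_mul_of_nonneg_right ?_ (norm_nonneg _)
    refine (norm_sub_le _ _).trans (add_le_add ?_ ?_)
    · exact (norm_smul_le_of_abs_le_one (Real.abs_sin_le_one _) _).trans
        (norm_cosTransform_le hγd k)
    · exact (norm_smul_le_of_abs_le_one (Real.abs_cos_le_one _) _).trans
        (norm_sinTransform_le hγd k)
  have hcs := integral_mul_mul_le_sqrt_mul_sqrt (μ := (volume : Measure E3)) (w := φhat)
    (a := fun k => ‖k‖ ^ 2) (b := N) hA.nonneg (fun k => by positivity) hN0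
    hA.integrable_hat.1 (Continuous.aestronglyMeasurable (by fun_prop)) hNc.aestronglyMeasurable
    hkint hNint
  have hprod : Integrable fun k => ‖k‖ ^ 2 * N k * φhat k := by
    refine (hkint.add hNint).mono' ?_ (.of_forall fun k => ?_)
    · exact (Continuous.aestronglyMeasurable (by fun_prop)).mul hA.integrable_hat.1
    · have h0 := hA.nonneg k
      have h1 := hN0 k
      rw [norm_of_nonneg (mul_nonneg (mul_nonneg (by positivity) h1) h0)]
      have h2 : ‖k‖ ^ 2 * N k ≤ (‖k‖ ^ 2) ^ 2 + N k ^ 2 := by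
        nlinarith [sq_nonneg (‖k‖ ^ 2 - N k), sq_nonneg (‖k‖ ^ 2 + N k)]
      simpa [add_mul] using mul_le_mul_of_nonneg_right h2 h0
  have hmain : ‖∫ k, (φhat k • cross3 k (Real.sin (inner ℝ k x) • C k -
      Real.cos (inner ℝ k x) • S k) - φhat k • cross3 k (Real.sin (inner ℝ k y) • C k -
      Real.cos (inner ℝ k y) • S k))‖ ≤ ∫ k, ‖x - y‖ * (‖k‖ ^ 2 * N k * φhat k) := by
    refine norm_integral_le_of_norm_le (hprod.const_mul _) (.of_forall fun k => ?_)
    have e : cross3 k (Real.sin (inner ℝ k x) • C k - Real.cos (inner ℝ k x) • S k) -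
        cross3 k (Real.sin (inner ℝ k y) • C k - Real.cos (inner ℝ k y) • S k) =
        cross3 k ((Real.sin (inner ℝ k x) - Real.sin (inner ℝ k y)) • C k -
          (Real.cos (inner ℝ k x) - Real.cos (inner ℝ k y)) • S k) := by
      rw [← crossCLM_apply, ← crossCLM_apply, ← crossCLM_apply, ← map_sub]
      congr 1
      module
    rw [← smul_sub, e, norm_smul, norm_of_nonneg (hA.nonneg k)]
    have h1 : |inner ℝ k x - inner ℝ k y| ≤ ‖k‖ * ‖x - y‖ := by
      rw [← inner_sub_right]
      exact abs_real_inner_le_norm _ _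
    have h2 := (norm_smul_sub_smul_le (Real.sin (inner ℝ k x) - Real.sin (inner ℝ k y))
      (Real.cos (inner ℝ k x) - Real.cos (inner ℝ k y)) (C k) (S k)).trans
      (mul_le_mul_of_nonneg_right ((sqrt_sin_sub_sq_add_cos_sub_sq_le _ _).trans h1) (hN0 k))
    have h3 := (norm_cross3_le k _).trans (mul_le_mul_of_nonneg_left h2 (norm_nonneg k))
    have h4 := mul_le_mul_of_nonneg_left h3 (hA.nonneg k)
    linarith
  have hc : (0:ℝ) < ((2 * π) ^ 3)⁻¹ := by positivity
  have hE : ∫ k, N k ^ 2 * φhat k = 2 * (2 * π) ^ 3 * energy φ γ γd := by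
    rw [hA.energy_eq hγ hγd]
    simp_rw [hNsq, mul_comm _ (φhat _)]
    field_simp
    rfl
  have hconst : ((2 * π) ^ 3)⁻¹ * Real.sqrt (2 * (2 * π) ^ 3) = 1 / (2 * π ^ ((3:ℝ) / 2)) := by
    have hp : π ^ ((3:ℝ) / 2) = Real.sqrt (π ^ 3) := by
      rw [Real.sqrt_eq_rpow, ← Real.rpow_natCast_mul pi_pos.le]
      norm_num
    have h16 : Real.sqrt (2 * (2 * π) ^ 3) = 4 * Real.sqrt (π ^ 3) := by
      rw [show 2 * (2 * π) ^ 3 = 4 ^ 2 * π ^ 3 by ring, Real.sqrt_mul (by positivity),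
        Real.sqrt_sq (by norm_num)]
    have hpos : 0 < Real.sqrt (π ^ 3) := Real.sqrt_pos.mpr (by positivity)
    have hsq : Real.sqrt (π ^ 3) ^ 2 = π ^ 3 := Real.sq_sqrt (by positivity)
    rw [hp, h16, mul_pow, ← hsq]
    field_simp
    norm_num
  rw [hA.velocity_eq hγ hγd, hA.velocity_eq hγ hγd, ← smul_sub, ← integral_sub (hint x) (hint y),
    norm_smul, norm_neg, norm_of_nonneg hc.le]
  rw [integral_const_mul] at hmain
  simp only [← pow_mul] at hcs
  rw [hE, Real.sqrt_mul (by positivity)] at hcs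
  rw [← hconst]
  have h5 := mul_le_mul_of_nonneg_left
    (hmain.trans (mul_le_mul_of_nonneg_left hcs (norm_nonneg (x - y)))) hc.le
  norm_num at h5 ⊢
  linarith

theorem contDiff_gradient {φ : E3 → ℝ} (hφ : ContDiff ℝ 2 φ) : ContDiff ℝ 1 (gradient φ) :=
  (InnerProductSpace.toDual ℝ E3).symm.contDiff.comp (hφ.fderiv_right (by norm_num))

theorem hasDerivAt_comp_gradient {φ : E3 → ℝ} (hφ : Differentiable ℝ φ) {f : ℝ → E3} {f' : E3}
    {t : ℝ} (hf : HasDerivAt f f' t) :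
    HasDerivAt (fun s => φ (f s)) (inner ℝ (gradient φ (f t)) f') t := by
  exact (hφ (f t)).hasGradientAt.hasFDerivAt.comp_hasDerivAt t hf

theorem HypA.gradient_neg {φ φhat : E3 → ℝ} (hA : HypA φ φhat) (x : E3) :
    gradient φ (-x) = -gradient φ x := by
  rw [hA.gradient_eq, hA.gradient_eq, ← smul_neg, ← integral_neg]
  simp [inner_neg_right, Real.sin_neg]

/-- The derivative along the curve of the velocity that the curve induces on itself. -/
def velocityDeriv (φ : E3 → ℝ) (γ γd : ℝ → E3) (ξ : ℝ) : E3 :=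
  ∫ η in (0:ℝ)..1, cross3 (fderiv ℝ (gradient φ) (γ ξ - γ η) (γd ξ)) (γd η)

theorem hasDerivAt_velocity {φ : E3 → ℝ} (hφ : ContDiff ℝ 2 φ) {γ γd : ℝ → E3}
    (hγ : ∀ ξ, HasDerivAt γ (γd ξ) ξ) (hγd : Continuous γd) (ξ : ℝ) :
    HasDerivAt (fun ξ => velocity φ γ γd (γ ξ)) (velocityDeriv φ γ γd ξ) ξ := by
  have hG := contDiff_gradient hφ
  have hGc := hG.continuous
  have hG' := hG.continuous_fderiv (by norm_num)
  have hγc : Continuous γ := continuous_iff_continuousAt.2 fun ξ => (hγ ξ).continuousAt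
  refine hasDerivAt_intervalIntegral_of_continuous
    (f := fun ξ η => cross3 (gradient φ (γ ξ - γ η)) (γd η))
    (f' := fun ξ η => cross3 (fderiv ℝ (gradient φ) (γ ξ - γ η) (γd ξ)) (γd η))
    (continuous_cross3 (by fun_prop) (by fun_prop))
    (continuous_cross3 (by fun_prop) (by fun_prop)) zero_le_one Filter.univ_mem
    fun x _ y _ => ?_
  have h1 : HasDerivAt (fun x => gradient φ (γ x - γ y))
      (fderiv ℝ (gradient φ) (γ x - γ y) (γd x)) x :=
    (hG.differentiable (by norm_num) _).hasFDerivAt.comp_hasDerivAt x ((hγ x).sub_const _)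
  exact (crossCLM.flip (γd y)).hasFDerivAt.comp_hasDerivAt x h1

theorem continuous_selfVelocity {φ : E3 → ℝ} (hφ : ContDiff ℝ 2 φ) {γ γd : ℝ → ℝ → E3}
    (hγ : Continuous fun p : ℝ × ℝ => γ p.1 p.2) (hγd : Continuous fun p : ℝ × ℝ => γd p.1 p.2) :
    Continuous fun p : ℝ × ℝ => velocity φ (γ p.1) (γd p.1) (γ p.1 p.2) := by
  have hGc := (contDiff_gradient hφ).continuous
  refine intervalIntegral.continuous_parametric_intervalIntegral_of_continuous'
    (f := fun (p : ℝ × ℝ) η => cross3 (gradient φ (γ p.1 p.2 - γ p.1 η)) (γd p.1 η)) ?_ 0 1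
  have h1 : Continuous fun q : (ℝ × ℝ) × ℝ => γ q.1.1 q.2 :=
    hγ.comp (by fun_prop : Continuous fun q : (ℝ × ℝ) × ℝ => (q.1.1, q.2))
  have h2 : Continuous fun q : (ℝ × ℝ) × ℝ => γd q.1.1 q.2 :=
    hγd.comp (by fun_prop : Continuous fun q : (ℝ × ℝ) × ℝ => (q.1.1, q.2))
  exact continuous_cross3 (hGc.comp ((hγ.comp continuous_fst).sub h1)) h2

theorem continuous_velocityDeriv {φ : E3 → ℝ} (hφ : ContDiff ℝ 2 φ) {γ γd : ℝ → ℝ → E3}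
    (hγ : Continuous fun p : ℝ × ℝ => γ p.1 p.2) (hγd : Continuous fun p : ℝ × ℝ => γd p.1 p.2) :
    Continuous fun p : ℝ × ℝ => velocityDeriv φ (γ p.1) (γd p.1) p.2 := by
  have hG' := (contDiff_gradient hφ).continuous_fderiv (by norm_num)
  refine intervalIntegral.continuous_parametric_intervalIntegral_of_continuous'
    (f := fun (p : ℝ × ℝ) η =>
      cross3 (fderiv ℝ (gradient φ) (γ p.1 p.2 - γ p.1 η) (γd p.1 p.2)) (γd p.1 η)) ?_ 0 1
  have h1 : Continuous fun q : (ℝ × ℝ) × ℝ => γ q.1.1 q.2 :=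
    hγ.comp (by fun_prop : Continuous fun q : (ℝ × ℝ) × ℝ => (q.1.1, q.2))
  have h2 : Continuous fun q : (ℝ × ℝ) × ℝ => γd q.1.1 q.2 :=
    hγd.comp (by fun_prop : Continuous fun q : (ℝ × ℝ) × ℝ => (q.1.1, q.2))
  have h3 : Continuous fun q : (ℝ × ℝ) × ℝ => γ q.1.1 q.1.2 := hγ.comp continuous_fst
  have h4 : Continuous fun q : (ℝ × ℝ) × ℝ => γd q.1.1 q.1.2 := hγd.comp continuous_fst
  exact continuous_cross3 ((hG'.comp (h3.sub h1)).clm_apply h4) h2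

/-- The first variation of the energy in the direction of the induced velocity vanishes. -/
theorem HypA.energy_variation_eq_zero {φ φhat : E3 → ℝ} (hA : HypA φ φhat) (hφ : ContDiff ℝ 2 φ)
    {γ γd V W : ℝ → E3} (hγ : ∀ ξ, HasDerivAt γ (γd ξ) ξ) (hγd : Continuous γd)
    (hV : ∀ ξ, HasDerivAt V (W ξ) ξ) (hW : Continuous W) (hclosed : γ 0 = γ 1)
    (hvel : ∀ ξ, V ξ = velocity φ γ γd (γ ξ)) :
    ∫ ξ in (0:ℝ)..1, ∫ η in (0:ℝ)..1,
      (inner ℝ (gradient φ (γ ξ - γ η)) (V ξ - V η) * inner ℝ (γd ξ) (γd η) +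
        φ (γ ξ - γ η) * (inner ℝ (W ξ) (γd η) + inner ℝ (γd ξ) (W η))) = 0 := by
  have hGc := (contDiff_gradient hφ).continuous
  have hφc := hA.cont
  have hγc : Continuous γ := continuous_iff_continuousAt.2 fun ξ => (hγ ξ).continuousAt
  have hVc : Continuous V := continuous_iff_continuousAt.2 fun ξ => (hV ξ).continuousAt
  let A : ℝ → ℝ → ℝ := fun ξ η => inner ℝ (gradient φ (γ ξ - γ η)) (V ξ) *
    inner ℝ (γd ξ) (γd η) + φ (γ ξ - γ η) * inner ℝ (W ξ) (γd η)
  let D : ℝ → ℝ → ℝ := fun ξ η => inner ℝ (gradient φ (γ ξ - γ η)) (γd ξ) *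
    inner ℝ (V ξ) (γd η) + φ (γ ξ - γ η) * inner ℝ (W ξ) (γd η)
  have hAc : Continuous fun p : ℝ × ℝ => A p.1 p.2 := by fun_prop
  have hDc : Continuous fun p : ℝ × ℝ => D p.1 p.2 := by fun_prop
  have hsplit : ∀ ξ η, inner ℝ (gradient φ (γ ξ - γ η)) (V ξ - V η) * inner ℝ (γd ξ) (γd η) +
        φ (γ ξ - γ η) * (inner ℝ (W ξ) (γd η) + inner ℝ (γd ξ) (W η)) = A ξ η + A η ξ := by
    intro ξ η
    simp only [A]
    rw [← neg_sub (γ ξ) (γ η), hA.gradient_neg, hA.even, inner_neg_left, inner_sub_right,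
      real_inner_comm (γd ξ) (γd η), real_inner_comm (γd ξ) (W η)]
    ring
  have hD0 : ∀ η, ∫ ξ in (0:ℝ)..1, D ξ η = 0 := by
    intro η
    have hd : ∀ ξ, HasDerivAt (fun ξ => φ (γ ξ - γ η) * inner ℝ (V ξ) (γd η)) (D ξ η) ξ := by
      intro ξ
      have h1 := hasDerivAt_comp_gradient (hφ.differentiable (by norm_num))
        ((hγ ξ).sub_const (γ η))
      have h2 : HasDerivAt (fun ξ => (inner ℝ (V ξ) (γd η) : ℝ)) (inner ℝ (W ξ) (γd η)) ξ := by
        simpa using (hV ξ).inner ℝ (hasDerivAt_const ξ (γd η))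
      exact h1.mul h2
    rw [intervalIntegral.integral_eq_sub_of_hasDerivAt (fun ξ _ => hd ξ)
      (Continuous.intervalIntegrable (by fun_prop) 0 1), hvel, hvel, hclosed, sub_self]
  have hAD : ∀ ξ, ∫ η in (0:ℝ)..1, (A ξ η - D ξ η) = 0 := by
    intro ξ
    have hi : IntervalIntegrable (fun η => cross3 (gradient φ (γ ξ - γ η)) (γd η)) volume 0 1 :=
      (continuous_cross3 (by fun_prop) (by fun_prop)).intervalIntegrable 0 1
    have h := (innerSL ℝ (cross3 (V ξ) (γd ξ))).intervalIntegral_comp_comm hi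
    have hv : ∫ η in (0:ℝ)..1, cross3 (gradient φ (γ ξ - γ η)) (γd η) = V ξ := (hvel ξ).symm
    rw [hv, innerSL_apply_apply, real_inner_comm, inner_cross3_self] at h
    rw [← h]
    congr 1
    ext η
    rw [innerSL_apply_apply, real_inner_comm, inner_cross3_cross3]
    simp only [A, D]
    rw [real_inner_comm (γd ξ) (γd η), real_inner_comm (V ξ) (γd η)]
    ring
  have hA0 : ∫ ξ in (0:ℝ)..1, ∫ η in (0:ℝ)..1, A ξ η = 0 := by
    have e : ∀ ξ, ∫ η in (0:ℝ)..1, A ξ η = ∫ η in (0:ℝ)..1, D ξ η := fun ξ => by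
      rw [← sub_eq_zero, ← intervalIntegral.integral_sub
        (Continuous.intervalIntegrable (by fun_prop) 0 1)
        (Continuous.intervalIntegrable (by fun_prop) 0 1), hAD]
    simp_rw [e]
    rw [intervalIntegral_swap_of_continuous hDc zero_le_one zero_le_one]
    simp [hD0]
  simp_rw [hsplit]
  have hadd : ∀ ξ, ∫ η in (0:ℝ)..1, (A ξ η + A η ξ) =
      (∫ η in (0:ℝ)..1, A ξ η) + ∫ η in (0:ℝ)..1, A η ξ := fun ξ =>
    intervalIntegral.integral_add (Continuous.intervalIntegrable (by fun_prop) 0 1)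
      (Continuous.intervalIntegrable (by fun_prop) 0 1)
  simp_rw [hadd]
  rw [intervalIntegral.integral_add (Continuous.intervalIntegrable (by fun_prop) 0 1)
      (Continuous.intervalIntegrable (by fun_prop) 0 1), hA0, zero_add,
    ← intervalIntegral_swap_of_continuous hAc zero_le_one zero_le_one, hA0]

section slices

variable {X Y Z : Type*} [TopologicalSpace X] [TopologicalSpace Y] [TopologicalSpace Z]
  {f : X → Y → Z}

theorem continuous_swap_args (hf : Continuous fun p : X × Y => f p.1 p.2) :
    Continuous fun p : Y × X => f p.2 p.1 :=
  hf.comp continuous_swap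

theorem continuous_right_arg (hf : Continuous fun p : X × Y => f p.1 p.2) (x : X) :
    Continuous fun y => f x y :=
  hf.comp (by fun_prop : Continuous fun y => (x, y))

theorem continuous_left_arg (hf : Continuous fun p : X × Y => f p.1 p.2) (y : Y) :
    Continuous fun x => f x y :=
  hf.comp (by fun_prop : Continuous fun x => (x, y))

end slices

/-- Differentiation of a double integral with respect to a parameter. -/
theorem hasDerivAt_double_intervalIntegral {F F' : ℝ → ℝ → ℝ → ℝ}
    (hFc : Continuous fun q : (ℝ × ℝ) × ℝ => F q.1.1 q.1.2 q.2)
    (hF'c : Continuous fun q : (ℝ × ℝ) × ℝ => F' q.1.1 q.1.2 q.2)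
    {s : ℝ} {I : Set ℝ} (hI : I ∈ nhds s)
    (hpt : ∀ r ∈ I, ∀ ξ ∈ Ioo (0:ℝ) 1, ∀ η ∈ Ioo (0:ℝ) 1,
      HasDerivAt (fun t => F t ξ η) (F' r ξ η) r) :
    HasDerivAt (fun t => ∫ ξ in (0:ℝ)..1, ∫ η in (0:ℝ)..1, F t ξ η)
      (∫ ξ in (0:ℝ)..1, ∫ η in (0:ℝ)..1, F' s ξ η) s := by
  have hIc : Continuous fun p : ℝ × ℝ => ∫ η in (0:ℝ)..1, F p.1 p.2 η :=
    intervalIntegral.continuous_parametric_intervalIntegral_of_continuous'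
      (f := fun (p : ℝ × ℝ) η => F p.1 p.2 η) hFc 0 1
  have hI'c : Continuous fun p : ℝ × ℝ => ∫ η in (0:ℝ)..1, F' p.1 p.2 η :=
    intervalIntegral.continuous_parametric_intervalIntegral_of_continuous'
      (f := fun (p : ℝ × ℝ) η => F' p.1 p.2 η) hF'c 0 1
  have hinner : ∀ r ∈ interior I, ∀ ξ ∈ Ioo (0:ℝ) 1,
      HasDerivAt (fun t => ∫ η in (0:ℝ)..1, F t ξ η) (∫ η in (0:ℝ)..1, F' r ξ η) r :=
    fun r hr ξ hξ => hasDerivAt_intervalIntegral_of_continuous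
      (f := fun t η => F t ξ η) (f' := fun t η => F' t ξ η)
      (hFc.comp (by fun_prop : Continuous fun p : ℝ × ℝ => ((p.1, ξ), p.2)))
      (hF'c.comp (by fun_prop : Continuous fun p : ℝ × ℝ => ((p.1, ξ), p.2))) zero_le_one
      (mem_interior_iff_mem_nhds.1 hr) fun x hx η hη => hpt x hx ξ hξ η hη
  exact hasDerivAt_intervalIntegral_of_continuous
    (f := fun t ξ => ∫ η in (0:ℝ)..1, F t ξ η) (f' := fun t ξ => ∫ η in (0:ℝ)..1, F' t ξ η)
    hIc hI'c zero_le_one (interior_mem_nhds.2 hI) hinner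

section partials

variable {E : Type*} [NormedAddCommGroup E] [NormedSpace ℝ E] {γ : ℝ → ℝ → E}

theorem hasDerivAt_snd_of_contDiff (h : ContDiff ℝ 1 fun p : ℝ × ℝ => γ p.1 p.2) (t ξ : ℝ) :
    HasDerivAt (γ t) (fderiv ℝ (fun p : ℝ × ℝ => γ p.1 p.2) (t, ξ) (0, 1)) ξ :=
  (h.differentiable (by norm_num) (t, ξ)).hasFDerivAt.comp_hasDerivAt ξ
    ((hasDerivAt_const ξ t).prodMk (hasDerivAt_id ξ))

theorem hasDerivAt_fst_of_contDiff (h : ContDiff ℝ 1 fun p : ℝ × ℝ => γ p.1 p.2) (t ξ : ℝ) :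
    HasDerivAt (fun s => γ s ξ) (fderiv ℝ (fun p : ℝ × ℝ => γ p.1 p.2) (t, ξ) (1, 0)) t :=
  HasFDerivAt.comp_hasDerivAt (f := fun s => (s, ξ)) t
    (h.differentiable (by norm_num) (t, ξ)).hasFDerivAt
    ((hasDerivAt_id t).prodMk (hasDerivAt_const t ξ))

theorem continuous_deriv_snd (h : ContDiff ℝ 1 fun p : ℝ × ℝ => γ p.1 p.2) :
    Continuous fun p : ℝ × ℝ => deriv (γ p.1) p.2 := by
  simp_rw [fun t ξ => (hasDerivAt_snd_of_contDiff h t ξ).deriv]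
  exact (h.continuous_fderiv (by norm_num)).clm_apply continuous_const

end partials

/-- The tangent vector of a solution is differentiable in time. -/
theorem hasDerivAt_tangent {φ : E3 → ℝ} (hφ : ContDiff ℝ 2 φ) {T : ℝ} {γ : ℝ → ℝ → E3}
    (hsmooth : ContDiff ℝ 1 (fun p : ℝ × ℝ => γ p.1 p.2))
    (heq : ∀ t ∈ Icc (0:ℝ) T, ∀ ξ ∈ Icc (0:ℝ) 1,
      deriv (fun s => γ s ξ) t = velocity φ (γ t) (deriv (γ t)) (γ t ξ))
    {t ξ : ℝ} (ht : t ∈ Ioo 0 T) (hξ : ξ ∈ Ioo (0:ℝ) 1) :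
    HasDerivAt (fun s => deriv (γ s) ξ) (velocityDeriv φ (γ t) (deriv (γ t)) ξ) t := by
  have hγd := continuous_deriv_snd hsmooth
  have hγx : ∀ t ξ, HasDerivAt (γ t) (deriv (γ t) ξ) ξ := fun t ξ =>
    (hasDerivAt_snd_of_contDiff hsmooth t ξ).differentiableAt.hasDerivAt
  have hγdt : ∀ t, Continuous (deriv (γ t)) := fun t =>
    continuous_right_arg (f := fun t => deriv (γ t)) hγd t
  have hW := continuous_velocityDeriv (γd := fun t => deriv (γ t)) hφ hsmooth.continuous hγd
  have hV := continuous_selfVelocity (γd := fun t => deriv (γ t)) hφ hsmooth.continuous hγd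
  have hduhamel : ∀ s ∈ Ioo 0 T, deriv (γ s) ξ =
      deriv (γ 0) ξ + ∫ r in (0:ℝ)..s, velocityDeriv φ (γ r) (deriv (γ r)) ξ := by
    intro s hs
    have hftc : ∀ y ∈ Ioo (0:ℝ) 1, γ 0 y +
        ∫ r in (0:ℝ)..s, velocity φ (γ r) (deriv (γ r)) (γ r y) = γ s y := by
      intro y hy
      have hint : IntervalIntegrable (fun r => velocity φ (γ r) (deriv (γ r)) (γ r y)) volume 0 s :=
        (continuous_left_arg (f := fun r y => velocity φ (γ r) (deriv (γ r)) (γ r y))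
          hV y).intervalIntegrable 0 s
      rw [intervalIntegral.integral_eq_sub_of_hasDerivAt (f := fun r => γ r y) (fun r hr => ?_) hint]
      · abel
      · rw [uIcc_of_le hs.1.le] at hr
        rw [← heq r ⟨hr.1, hr.2.trans hs.2.le⟩ y ⟨hy.1.le, hy.2.le⟩]
        exact (hasDerivAt_fst_of_contDiff hsmooth r y).differentiableAt.hasDerivAt
    have hd := (hγx 0 ξ).add (hasDerivAt_intervalIntegral_of_continuous
      (f := fun y r => velocity φ (γ r) (deriv (γ r)) (γ r y))
      (f' := fun y r => velocityDeriv φ (γ r) (deriv (γ r)) y)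
      (continuous_swap_args (f := fun r y => velocity φ (γ r) (deriv (γ r)) (γ r y)) hV)
      (continuous_swap_args (f := fun r y => velocityDeriv φ (γ r) (deriv (γ r)) y) hW) hs.1.le Filter.univ_mem
      fun y _ r _ => hasDerivAt_velocity hφ (hγx r) (hγdt r) y)
    refine HasDerivAt.deriv (hd.congr_of_eventuallyEq ?_)
    filter_upwards [Ioo_mem_nhds hξ.1 hξ.2] with y hy
    exact (hftc y hy).symm
  have hc : Continuous fun r => velocityDeriv φ (γ r) (deriv (γ r)) ξ :=
    continuous_left_arg (f := fun r y => velocityDeriv φ (γ r) (deriv (γ r)) y) hW ξ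
  refine HasDerivAt.congr_of_eventuallyEq
    ((intervalIntegral.integral_hasDerivAt_right (hc.intervalIntegrable 0 t)
      (hc.stronglyMeasurableAtFilter _ _) hc.continuousAt).const_add (deriv (γ 0) ξ)) ?_
  filter_upwards [Ioo_mem_nhds ht.1 ht.2] with s hs using hduhamel s hs

/-- The first variation of the energy. -/
theorem hasDerivAt_energy {φ : E3 → ℝ} (hφ : ContDiff ℝ 2 φ) {γ d V W : ℝ → ℝ → E3}
    (hγc : Continuous fun p : ℝ × ℝ => γ p.1 p.2) (hdc : Continuous fun p : ℝ × ℝ => d p.1 p.2)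
    (hVc : Continuous fun p : ℝ × ℝ => V p.1 p.2) (hWc : Continuous fun p : ℝ × ℝ => W p.1 p.2)
    {s : ℝ} {I : Set ℝ} (hI : I ∈ nhds s)
    (hγ : ∀ r ∈ I, ∀ ξ ∈ Ioo (0:ℝ) 1, HasDerivAt (fun t => γ t ξ) (V r ξ) r)
    (hd : ∀ r ∈ I, ∀ ξ ∈ Ioo (0:ℝ) 1, HasDerivAt (fun t => d t ξ) (W r ξ) r) :
    HasDerivAt (fun t => energy φ (γ t) (d t)) (1 / 2 * ∫ ξ in (0:ℝ)..1, ∫ η in (0:ℝ)..1,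
      (inner ℝ (gradient φ (γ s ξ - γ s η)) (V s ξ - V s η) * inner ℝ (d s ξ) (d s η) +
        φ (γ s ξ - γ s η) * (inner ℝ (W s ξ) (d s η) + inner ℝ (d s ξ) (W s η)))) s := by
  have hφc := hφ.continuous
  have hGc := (contDiff_gradient hφ).continuous
  let F : ℝ → ℝ → ℝ → ℝ := fun t ξ η => φ (γ t ξ - γ t η) * inner ℝ (d t ξ) (d t η)
  let F' : ℝ → ℝ → ℝ → ℝ := fun t ξ η =>
    inner ℝ (gradient φ (γ t ξ - γ t η)) (V t ξ - V t η) * inner ℝ (d t ξ) (d t η) +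
      φ (γ t ξ - γ t η) * (inner ℝ (W t ξ) (d t η) + inner ℝ (d t ξ) (W t η))
  have hfst : ∀ {f : ℝ → ℝ → E3}, (Continuous fun p : ℝ × ℝ => f p.1 p.2) →
      Continuous fun q : (ℝ × ℝ) × ℝ => f q.1.1 q.1.2 := fun hf => hf.comp continuous_fst
  have hsnd : ∀ {f : ℝ → ℝ → E3}, (Continuous fun p : ℝ × ℝ => f p.1 p.2) →
      Continuous fun q : (ℝ × ℝ) × ℝ => f q.1.1 q.2 := fun hf =>
    hf.comp (by fun_prop : Continuous fun q : (ℝ × ℝ) × ℝ => (q.1.1, q.2))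
  have hdiff := (hfst hγc).sub (hsnd hγc)
  have hFc : Continuous fun q : (ℝ × ℝ) × ℝ => F q.1.1 q.1.2 q.2 :=
    (hφc.comp hdiff).mul ((hfst hdc).inner (hsnd hdc))
  have hF'c : Continuous fun q : (ℝ × ℝ) × ℝ => F' q.1.1 q.1.2 q.2 :=
    (((hGc.comp hdiff).inner ((hfst hVc).sub (hsnd hVc))).mul ((hfst hdc).inner (hsnd hdc))).add
      ((hφc.comp hdiff).mul (((hfst hWc).inner (hsnd hdc)).add ((hfst hdc).inner (hsnd hWc))))
  have hpt : ∀ r ∈ I, ∀ ξ ∈ Ioo (0:ℝ) 1, ∀ η ∈ Ioo (0:ℝ) 1,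
      HasDerivAt (fun t => F t ξ η) (F' r ξ η) r := by
    intro r hr ξ hξ η hη
    have h1 := hasDerivAt_comp_gradient (hφ.differentiable (by norm_num))
      ((hγ r hr ξ hξ).sub (hγ r hr η hη))
    have h2 := (hd r hr ξ hξ).inner ℝ (hd r hr η hη)
    refine (h1.mul h2).congr_deriv ?_
    simp only [F', Pi.sub_apply]
    ring
  exact (hasDerivAt_double_intervalIntegral hFc hF'c hI hpt).const_mul (1 / 2)

theorem HypA.continuous_energy {φ φhat : E3 → ℝ} (hA : HypA φ φhat) {γ d : ℝ → ℝ → E3}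
    (hγc : Continuous fun p : ℝ × ℝ => γ p.1 p.2) (hdc : Continuous fun p : ℝ × ℝ => d p.1 p.2) :
    Continuous fun t => energy φ (γ t) (d t) := by
  have hsnd : ∀ {f : ℝ → ℝ → E3}, (Continuous fun p : ℝ × ℝ => f p.1 p.2) →
      Continuous fun q : (ℝ × ℝ) × ℝ => f q.1.1 q.2 := fun hf =>
    hf.comp (by fun_prop : Continuous fun q : (ℝ × ℝ) × ℝ => (q.1.1, q.2))
  refine continuous_const.mul
    (intervalIntegral.continuous_parametric_intervalIntegral_of_continuous' ?_ 0 1)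
  refine intervalIntegral.continuous_parametric_intervalIntegral_of_continuous'
    (f := fun (p : ℝ × ℝ) η => φ (γ p.1 p.2 - γ p.1 η) * inner ℝ (d p.1 p.2) (d p.1 η)) ?_ 0 1
  exact (hA.cont.comp ((hγc.comp continuous_fst).sub (hsnd hγc))).mul
    ((hdc.comp continuous_fst).inner (hsnd hdc))

/-- The energy is conserved along solutions. -/
theorem HypA.energy_eq_energy_zero {φ φhat : E3 → ℝ} (hA : HypA φ φhat) (hφ : ContDiff ℝ 2 φ)
    {T : ℝ} {γ : ℝ → ℝ → E3}
    (hsmooth : ContDiff ℝ 1 (fun p : ℝ × ℝ => γ p.1 p.2))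
    (hclosed : ∀ t ∈ Icc (0:ℝ) T, γ t 0 = γ t 1)
    (heq : ∀ t ∈ Icc (0:ℝ) T, ∀ ξ ∈ Icc (0:ℝ) 1,
      deriv (fun s => γ s ξ) t = velocity φ (γ t) (deriv (γ t)) (γ t ξ))
    {t : ℝ} (ht : t ∈ Icc 0 T) :
    energy φ (γ t) (deriv (γ t)) = energy φ (γ 0) (deriv (γ 0)) := by
  have hγc := hsmooth.continuous
  have hγd := continuous_deriv_snd hsmooth
  have hγx : ∀ t ξ, HasDerivAt (γ t) (deriv (γ t) ξ) ξ := fun t ξ =>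
    (hasDerivAt_snd_of_contDiff hsmooth t ξ).differentiableAt.hasDerivAt
  have hγdt : ∀ t, Continuous (deriv (γ t)) := fun t =>
    continuous_right_arg (f := fun t => deriv (γ t)) hγd t
  have hW := continuous_velocityDeriv (γd := fun t => deriv (γ t)) hφ hγc hγd
  have hV := continuous_selfVelocity (γd := fun t => deriv (γ t)) hφ hγc hγd
  have hcont := hA.continuous_energy (d := fun t => deriv (γ t)) hγc hγd
  have hderiv : ∀ s ∈ Ioo 0 T, HasDerivAt (fun t => energy φ (γ t) (deriv (γ t))) 0 s := by
    intro s hs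
    have h := hasDerivAt_energy (d := fun t => deriv (γ t))
      (V := fun t ξ => velocity φ (γ t) (deriv (γ t)) (γ t ξ))
      (W := fun t ξ => velocityDeriv φ (γ t) (deriv (γ t)) ξ) hφ hγc hγd hV hW
      (Ioo_mem_nhds hs.1 hs.2)
      (fun r hr ξ hξ => by
        rw [← heq r ⟨hr.1.le, hr.2.le⟩ ξ ⟨hξ.1.le, hξ.2.le⟩]
        exact (hasDerivAt_fst_of_contDiff hsmooth r ξ).differentiableAt.hasDerivAt)
      (fun r hr ξ hξ => hasDerivAt_tangent hφ hsmooth heq hr hξ)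
    have hzero := hA.energy_variation_eq_zero hφ (hγx s) (hγdt s)
      (V := fun ξ => velocity φ (γ s) (deriv (γ s)) (γ s ξ))
      (W := fun ξ => velocityDeriv φ (γ s) (deriv (γ s)) ξ)
      (hasDerivAt_velocity hφ (hγx s) (hγdt s))
      (continuous_right_arg (f := fun r y => velocityDeriv φ (γ r) (deriv (γ r)) y) hW s)
      (hclosed s ⟨hs.1.le, hs.2.le⟩) fun ξ => rfl
    exact h.congr_deriv (by rw [hzero, mul_zero])
  rcases ht.1.eq_or_lt with h0 | h0
  · rw [← h0]
  obtain ⟨c, hc, hc'⟩ := exists_hasDerivAt_eq_slope _ (fun _ => 0) h0 hcont.continuousOn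
    fun s hs => hderiv s ⟨hs.1, hs.2.trans_le ht.2⟩
  rw [eq_comm, div_eq_zero_iff] at hc'
  rcases hc' with h | h
  · exact sub_eq_zero.1 h
  · exact absurd h (by linarith)

/-- Exponential bound on the tangent vector of a flow with Lipschitz velocity. -/
theorem norm_tangent_le_of_lipschitz {T L : ℝ} {γ : ℝ → ℝ → E3} {u : ℝ → E3 → E3}
    (hsmooth : ContDiff ℝ 1 (fun p : ℝ × ℝ => γ p.1 p.2))
    (heq : ∀ t ∈ Icc (0:ℝ) T, ∀ ξ ∈ Icc (0:ℝ) 1, deriv (fun s => γ s ξ) t = u t (γ t ξ))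
    (hu : ∀ t ∈ Icc (0:ℝ) T, ∀ x y, ‖u t x - u t y‖ ≤ L * ‖x - y‖)
    {t ξ : ℝ} (ht : t ∈ Icc 0 T) (hξ : ξ ∈ Ioo (0:ℝ) 1) :
    ‖deriv (γ t) ξ‖ ≤ ‖deriv (γ 0) ξ‖ * Real.exp (L * t) := by
  have hγt : ∀ y s, HasDerivAt (fun s => γ s y) (deriv (fun s => γ s y) s) s := fun y s =>
    (hasDerivAt_fst_of_contDiff hsmooth s y).differentiableAt.hasDerivAt
  have hgron : ∀ y ∈ Ioo (0:ℝ) 1, ‖γ t y - γ t ξ‖ ≤ ‖γ 0 y - γ 0 ξ‖ * Real.exp (L * t) := by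
    intro y hy
    have hd : ∀ s, HasDerivAt (fun s => γ s y - γ s ξ)
        (deriv (fun s => γ s y) s - deriv (fun s => γ s ξ) s) s := fun s =>
      (hγt y s).sub (hγt ξ s)
    have h := norm_le_gronwallBound_of_norm_deriv_right_le (f := fun s => γ s y - γ s ξ)
      (δ := ‖γ 0 y - γ 0 ξ‖) (K := L) (ε := 0) (a := 0) (b := T)
      (fun s _ => (hd s).continuousAt.continuousWithinAt) (fun s _ => (hd s).hasDerivWithinAt)
      le_rfl (fun s hs => ?_) t ht
    · rwa [gronwallBound_ε0, sub_zero] at h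
    · have hs' : s ∈ Icc 0 T := ⟨hs.1, hs.2.le⟩
      rw [heq s hs' y ⟨hy.1.le, hy.2.le⟩, heq s hs' ξ ⟨hξ.1.le, hξ.2.le⟩, add_zero]
      exact hu s hs' _ _
  have hslope : ∀ s, Filter.Tendsto (fun y => ‖slope (γ s) ξ y‖) (nhdsWithin ξ {ξ}ᶜ)
      (nhds ‖deriv (γ s) ξ‖) := fun s =>
    (hasDerivAt_iff_tendsto_slope.1
      (hasDerivAt_snd_of_contDiff hsmooth s ξ).differentiableAt.hasDerivAt).norm
  refine le_of_tendsto_of_tendsto (hslope t) ((hslope 0).mul_const _) ?_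
  filter_upwards [mem_nhdsWithin_of_mem_nhds (Ioo_mem_nhds hξ.1 hξ.2)] with y hy
  simp only [slope_def_module, norm_smul]
  rw [mul_assoc]
  exact mul_le_mul_of_nonneg_left (hgron y hy) (norm_nonneg _)

/-- A priori estimate: along `C¹` solutions of the regularized filament equation,
`‖∂_ξγ(t,·)‖_{L²} ≤ ‖∂_ξγ(0,·)‖_{L²} exp(C H(γ(0,·))^{1/2} t)` with
`C = (1/(2π^{3/2})) (∫ |k|⁴ φ̂(k) dk)^{1/2}`. -/
theorem derivative_L2_growth_bound (φ φhat : E3 → ℝ) (hA : HypA φ φhat)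
    (hφ2 : ContDiff ℝ 2 φ) (T : ℝ) (hT : 0 < T) (γ : ℝ → ℝ → E3)
    (hsmooth : ContDiff ℝ 1 (fun p : ℝ × ℝ => γ p.1 p.2))
    (hclosed : ∀ t ∈ Icc (0:ℝ) T, γ t 0 = γ t 1)
    (heq : ∀ t ∈ Icc (0:ℝ) T, ∀ ξ ∈ Icc (0:ℝ) 1,
      deriv (fun s => γ s ξ) t = velocity φ (γ t) (deriv (γ t)) (γ t ξ)) :
    ∀ t ∈ Icc (0:ℝ) T,
      Real.sqrt (∫ ξ in (0:ℝ)..1, ‖deriv (γ t) ξ‖ ^ 2) ≤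
        Real.sqrt (∫ ξ in (0:ℝ)..1, ‖deriv (γ 0) ξ‖ ^ 2) *
          Real.exp ((1 / (2 * π ^ ((3:ℝ) / 2))) *
            Real.sqrt (∫ k : E3, ‖k‖ ^ 4 * φhat k) *
              Real.sqrt (energy φ (γ 0) (deriv (γ 0))) * t) := by
  intro t ht
  have hγd := continuous_deriv_snd hsmooth
  have hγc : ∀ s, Continuous (γ s) := fun s =>
    hsmooth.continuous.comp (by fun_prop : Continuous fun ξ => (s, ξ))
  have hγdt : ∀ s, Continuous (deriv (γ s)) := fun s =>
    hγd.comp (by fun_prop : Continuous fun ξ => (s, ξ))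
  set L := (1 / (2 * π ^ ((3:ℝ) / 2))) * Real.sqrt (∫ k : E3, ‖k‖ ^ 4 * φhat k) *
    Real.sqrt (energy φ (γ 0) (deriv (γ 0))) with hL
  have hpt : ∀ ξ ∈ Ioo (0:ℝ) 1, ‖deriv (γ t) ξ‖ ≤ ‖deriv (γ 0) ξ‖ * Real.exp (L * t) :=
    fun ξ hξ => norm_tangent_le_of_lipschitz
      (u := fun t => velocity φ (γ t) (deriv (γ t))) hsmooth heq
      (fun s hs x y => by
        rw [hL, ← hA.energy_eq_energy_zero hφ2 hsmooth hclosed heq hs]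
        exact hA.norm_velocity_sub_le (hγc s) (hγdt s) x y) ht hξ
  have hle : ∫ ξ in (0:ℝ)..1, ‖deriv (γ t) ξ‖ ^ 2 ≤
      (∫ ξ in (0:ℝ)..1, ‖deriv (γ 0) ξ‖ ^ 2) * Real.exp (L * t) ^ 2 := by
    rw [← intervalIntegral.integral_mul_const]
    refine intervalIntegral.integral_mono_on_of_le_Ioo zero_le_one
      (((hγdt t).norm.pow 2).intervalIntegrable 0 1)
      ((((hγdt 0).norm.pow 2).mul continuous_const).intervalIntegrable 0 1) fun ξ hξ => ?_
    rw [← mul_pow]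
    exact pow_le_pow_left₀ (norm_nonneg _) (hpt ξ hξ) 2
  refine (Real.sqrt_le_sqrt hle).trans_eq ?_
  rw [Real.sqrt_mul' _ (by positivity), Real.sqrt_sq (Real.exp_pos _).le]
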